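/- arXiv:1309.5544 — 6 statements merged into one kernel-verified Lean document; each statement's English description precedes it below -/
import Mathlib

section
/- Let M be an alternating Turing machine and c a configuration of M, and let c₁,…,c_m be exactly the configurations c' with c → c'. If c is existential, then c is rejected iff every cᵢ is rejected; if c is universal, then c is rejected iff some cᵢ is rejected. -/
namespace ATMPaper

/-- Actions of a Turing machine: overwrite the scanned symbol by a letter,
move the cursor backward (`left`), or forward (`right`). -/
inductive Act (Γ : Type) : Type
  | write : Γ → Act Γ
  | left : Act Γ
  | right : Act Γ

/-- A cursored tape `u γ̲ v`: the string `u` to the left of the cursor,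
the scanned symbol `γ`, and the string `v` to the right. -/
abbrev Tape (Γ : Type) : Type := List Γ × Γ × List Γ

/-- The scanned symbol of a cursored tape. -/
def Tape.scan {Γ : Type} (t : Tape Γ) : Γ := t.2.1

/-- The effect of an action on a cursored tape (with blank symbol `blank`):
moving forward past the right end extends the tape with a blank, and moving
backward at the left end leaves the cursor in place. -/
inductive ActStep {Γ : Type} (blank : Γ) : Act Γ → Tape Γ → Tape Γ → Prop
  | fwd (u : List Γ) (γ τ : Γ) (v : List Γ) :
      ActStep blank Act.right (u, γ, τ :: v) (u ++ [γ], τ, v)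
  | fwdEnd (u : List Γ) (γ : Γ) :
      ActStep blank Act.right (u, γ, []) (u ++ [γ], blank, [])
  | bwd (u : List Γ) (τ γ : Γ) (v : List Γ) :
      ActStep blank Act.left (u ++ [τ], γ, v) (u, τ, γ :: v)
  | bwdEnd (γ : Γ) (v : List Γ) :
      ActStep blank Act.left ([], γ, v) ([], γ, v)
  | write (u : List Γ) (γ τ : Γ) (v : List Γ) :
      ActStep blank (Act.write τ) (u, γ, v) (u, τ, v)

section Generic

variable {C : Type*} (isE : C → Bool) (step : C → C → Prop)

/-- A chain of steps `c = c₀ → ⋯ → cₙ = c'` (`n ≥ 0`) in which `c₀,…,cₙ₋₁`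
are all existential. -/
inductive EChain : C → C → Prop
  | refl (c : C) : EChain c c
  | step {c c' c'' : C} : isE c = true → step c c' → EChain c' c'' → EChain c c''

/-- A chain of steps `c = c₀ → ⋯ → cₙ = c'` (`n ≥ 0`) in which `c₀,…,cₙ₋₁`
are all universal. -/
inductive UChain : C → C → Prop
  | refl (c : C) : UChain c c
  | step {c c' c'' : C} : isE c = false → step c c' → UChain c' c'' → UChain c c''

/-- `c ⇑∃ c'` : `c'` is universal and reachable from `c` by a chain passing
only through existential configurations. -/
def EPivot (c c' : C) : Prop := EChain isE step c c' ∧ isE c' = false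

/-- `c ⇑∀ c'` : `c'` is existential and reachable from `c` by a chain passing
only through universal configurations. -/
def UPivot (c c' : C) : Prop := UChain isE step c c' ∧ isE c' = true

/-- The set `AC` of accepted configurations: the least set `S` such that
(i) an existential `c` with some pivot `c ⇑∃ c'`, `c' ∈ S`, is in `S`, and
(ii) a universal `c` all of whose pivots `c ⇑∀ c'` lie in `S` is in `S`. -/
inductive Accepted : C → Prop
  | ex {c c' : C} : isE c = true → EPivot isE step c c' → Accepted c' → Accepted c
  | univ {c : C} : isE c = false → (∀ c', UPivot isE step c c' → Accepted c') →
      Accepted c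

/-- The set `RC` of rejected configurations: the least set `S` such that
(i) an existential `c` all of whose pivots `c ⇑∃ c'` lie in `S` is in `S`, and
(ii) a universal `c` with some pivot `c ⇑∀ c'`, `c' ∈ S`, is in `S`. -/
inductive Rejected : C → Prop
  | ex {c : C} : isE c = true → (∀ c', EPivot isE step c c' → Rejected c') →
      Rejected c
  | univ {c c' : C} : isE c = false → UPivot isE step c c' → Rejected c' →
      Rejected c

end Generic

/-- An alternating Turing machine over input alphabet `α`, with (finite)
machine alphabet `Γ` into which `α` embeds, a blank symbol (not a letter
of `α`), a finite set `Q` of states each of which is existential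
(`isE q = true`) or universal (`isE q = false`), a start state, and a
transition relation `δ`. -/
structure ATM (α Γ : Type) where
  ΓFin : Finite Γ
  emb : α ↪ Γ
  blank : Γ
  blank_ne : ∀ a : α, emb a ≠ blank
  Q : Type
  QFin : Finite Q
  isE : Q → Bool
  start : Q
  δ : Q → Γ → Act Γ → Q → Prop

namespace ATM

variable {α Γ : Type} (M : ATM α Γ)

/-- A configuration: a state together with a cursored tape. -/
abbrev Cfg : Type := M.Q × Tape Γ

/-- A configuration is existential or universal according to its state. -/
def cfgE (c : M.Cfg) : Bool := M.isE c.1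

/-- The one-step yield relation between configurations. -/
def Yield (c c' : M.Cfg) : Prop :=
  ∃ a : Act Γ, M.δ c.1 (Tape.scan c.2) a c'.1 ∧ ActStep M.blank a c.2 c'.2

/-- `c ⇑∃ c'` for configurations of `M`. -/
def EPiv (c c' : M.Cfg) : Prop := ATMPaper.EPivot M.cfgE M.Yield c c'

/-- `c ⇑∀ c'` for configurations of `M`. -/
def UPiv (c c' : M.Cfg) : Prop := ATMPaper.UPivot M.cfgE M.Yield c c'

/-- `c` is an accepted configuration of `M`. -/
def Accepted (c : M.Cfg) : Prop := ATMPaper.Accepted M.cfgE M.Yield c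

/-- `c` is a rejected configuration of `M`. -/
def Rejected (c : M.Cfg) : Prop := ATMPaper.Rejected M.cfgE M.Yield c

/-- The initial configuration `(s₀, ε, ⊔, w)` for input `w`. -/
def init (w : List α) : M.Cfg := (M.start, ([], M.blank, w.map M.emb))

/-- `M` accepts the input string `w`. -/
def Accepts (w : List α) : Prop := M.Accepted (M.init w)

/-- `M` rejects the input string `w`. -/
def Rejects (w : List α) : Prop := M.Rejected (M.init w)

/-- The language `L(M)` accepted by `M`. -/
def Lang : Set (List α) := {w | M.Accepts w}

/-- The language `L̄(M)` rejected by `M`. -/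
def coLang : Set (List α) := {w | M.Rejects w}

/-- `M` is total: every input is either accepted or rejected. -/
def Total : Prop := ∀ w : List α, M.Accepts w ∨ M.Rejects w

/-- `M` is one-sided: it has no accepted configurations, or no rejected ones. -/
def OneSided : Prop :=
  (∀ c : M.Cfg, ¬ M.Accepted c) ∨ (∀ c : M.Cfg, ¬ M.Rejected c)

/-- The dual machine: same data, with existential and universal states
interchanged. -/
def dual : ATM α Γ :=
  ⟨M.ΓFin, M.emb, M.blank, M.blank_ne, M.Q, M.QFin,
    fun q => !M.isE q, M.start, M.δ⟩

/-- `M` is alternation well-founded: for no input `w` is there an infinite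
sequence of yield-steps from the initial configuration for `w` in which the
type (existential/universal) changes infinitely often. -/
def AltWF : Prop :=
  ∀ w : List α, ¬∃ d : ℕ → M.Cfg, d 0 = M.init w ∧
    (∀ i : ℕ, M.Yield (d i) (d (i + 1))) ∧
    (∀ n : ℕ, ∃ m : ℕ, n ≤ m ∧ M.cfgE (d m) ≠ M.cfgE (d (m + 1)))

/-- Every chain of yield-steps from an initial configuration of `M` has at
most `k` alternation-pivots, i.e. at most `k` indices at which the type of
the configuration changes. -/
def AltBound (k : ℕ) : Prop :=
  ∀ (w : List α) (n : ℕ) (d : ℕ → M.Cfg), d 0 = M.init w →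
    (∀ i < n, M.Yield (d i) (d (i + 1))) →
    ((Finset.range n).filter fun i => M.cfgE (d i) ≠ M.cfgE (d (i + 1))).card ≤ k

/-- `M` is a `Σ_k` machine: its start state is existential and every chain of
yield-steps from an initial configuration has at most `k` alternation-pivots. -/
def IsSigmaM (k : ℕ) : Prop := M.isE M.start = true ∧ M.AltBound k

/-- `M` is a `Π_k` machine: its start state is universal and every chain of
yield-steps from an initial configuration has at most `k` alternation-pivots;
moreover for `k = 1` no transition rule applies to any existential state. -/
def IsPiM (k : ℕ) : Prop :=
  M.isE M.start = false ∧ M.AltBound k ∧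
    (k = 1 → ∀ (q : M.Q) (γ : Γ) (a : Act Γ) (q' : M.Q),
      M.δ q γ a q' → M.isE q = false)

end ATM

/-- `AltQuant α k b P` is the statement `Q₁ x₁ Q₂ x₂ ⋯ Q_k x_k, P (x₁,…,x_k)`
where the quantifiers `Qᵢ` over `List α` alternate, starting with `∃` if
`b = true` and with `∀` if `b = false`. -/
def AltQuant (α : Type) : (k : ℕ) → Bool → ((Fin k → List α) → Prop) → Prop
  | 0, _, P => P fun i => i.elim0
  | k + 1, true, P => ∃ x : List α, AltQuant α k false fun v => P (Fin.cons x v)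
  | k + 1, false, P => ∀ x : List α, AltQuant α k true fun v => P (Fin.cons x v)

/-- `L ⊆ Σ*` is `Σ⁰_k`: definable by `k` alternating quantifiers over strings,
beginning with `∃`, applied to a computable relation. -/
def IsSigma0 (α : Type) [Primcodable α] (k : ℕ) (L : Set (List α)) : Prop :=
  ∃ R : List α × (Fin k → List α) → Prop, ComputablePred R ∧
    L = {w | AltQuant α k true fun v => R (w, v)}

/-- `L ⊆ Σ*` is `Π⁰_k`: definable by `k` alternating quantifiers over strings,
beginning with `∀`, applied to a computable relation. -/
def IsPi0 (α : Type) [Primcodable α] (k : ℕ) (L : Set (List α)) : Prop :=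
  ∃ R : List α × (Fin k → List α) → Prop, ComputablePred R ∧
    L = {w | AltQuant α k false fun v => R (w, v)}

/-- `L ⊆ Σ*` is inductive (`Π¹₁`): there is a computable relation
`R ⊆ Σ* × List (Σ*)` with
`L = {w | ∀ f : ℕ → Σ*, ∃ n, R (w, [f 0, …, f n])}`. -/
def IsInductive (α : Type) [Primcodable α] (L : Set (List α)) : Prop :=
  ∃ R : List α × List (List α) → Prop, ComputablePred R ∧
    L = {w | ∀ f : ℕ → List α, ∃ n : ℕ, R (w, (List.range (n + 1)).map f)}

/-- A two-tape alternating Turing machine: as `ATM`, but configurations carry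
two cursored tapes, and transitions read both scanned symbols and perform an
action on each tape. -/
structure ATM2 (α Γ : Type) where
  ΓFin : Finite Γ
  emb : α ↪ Γ
  blank : Γ
  blank_ne : ∀ a : α, emb a ≠ blank
  Q : Type
  QFin : Finite Q
  isE : Q → Bool
  start : Q
  δ : Q → Γ → Γ → Act Γ → Act Γ → Q → Prop

namespace ATM2

variable {α Γ : Type} (M : ATM2 α Γ)

/-- A configuration of a two-tape machine: a state and two cursored tapes. -/
abbrev Cfg : Type := M.Q × Tape Γ × Tape Γ

/-- A configuration is existential or universal according to its state. -/
def cfgE (c : M.Cfg) : Bool := M.isE c.1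

/-- The one-step yield relation of a two-tape machine. -/
def Yield (c c' : M.Cfg) : Prop :=
  ∃ a₀ a₁ : Act Γ, M.δ c.1 (Tape.scan c.2.1) (Tape.scan c.2.2) a₀ a₁ c'.1 ∧
    ActStep M.blank a₀ c.2.1 c'.2.1 ∧ ActStep M.blank a₁ c.2.2 c'.2.2

/-- `c ⇑∃ c'` for configurations of `M`. -/
def EPiv (c c' : M.Cfg) : Prop := ATMPaper.EPivot M.cfgE M.Yield c c'

/-- `c ⇑∀ c'` for configurations of `M`. -/
def UPiv (c c' : M.Cfg) : Prop := ATMPaper.UPivot M.cfgE M.Yield c c'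

/-- `c` is an accepted configuration of `M`. -/
def Accepted (c : M.Cfg) : Prop := ATMPaper.Accepted M.cfgE M.Yield c

/-- `c` is a rejected configuration of `M`. -/
def Rejected (c : M.Cfg) : Prop := ATMPaper.Rejected M.cfgE M.Yield c

/-- `M` accepts `w`: the configuration reached after the (deterministic)
pre-processing phase — the start state with the input copied onto both
tapes — is accepted. -/
def Accepts (w : List α) : Prop :=
  M.Accepted (M.start, ([], M.blank, w.map M.emb), ([], M.blank, w.map M.emb))

/-- `M` rejects `w`. -/
def Rejects (w : List α) : Prop :=
  M.Rejected (M.start, ([], M.blank, w.map M.emb), ([], M.blank, w.map M.emb))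

end ATM2

/-- The combined two-tape machine `M` of two single-tape machines `M₀`, `M₁`
over a common alphabet. Its states are triples `⟨q₀,q₁,j⟩` (`j : Bool`, with
`false` for `0` and `true` for `1`), typed according to `q_j`. In control
`j = 0`, a rule `(q₀,γ₀,a,p₀)` of `M₀` acts by `a` on tape `0`, leaves tape `1`
unchanged (re-writing its scanned symbol), and passes to control `0` if `q₀`
and `p₀` are both universal, and to control `1` otherwise; symmetrically, in
control `j = 1`, a rule `(q₁,γ₁,a,p₁)` of `M₁` acts by `a` on tape `1`, leaves
tape `0` unchanged, and passes to control `1` if `q₁` and `p₁` are both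
existential, and to control `0` otherwise. -/
def combine {α Γ : Type} (M₀ M₁ : ATM α Γ) : ATM2 α Γ where
  ΓFin := M₀.ΓFin
  emb := M₀.emb
  blank := M₀.blank
  blank_ne := M₀.blank_ne
  Q := M₀.Q × M₁.Q × Bool
  QFin := by haveI := M₀.QFin; haveI := M₁.QFin; infer_instance
  isE := fun s => cond s.2.2 (M₁.isE s.2.1) (M₀.isE s.1)
  start := (M₀.start, M₁.start, false)
  δ := fun s γ₀ γ₁ a₀ a₁ p =>
    (s.2.2 = false ∧ ∃ p₀ : M₀.Q, M₀.δ s.1 γ₀ a₀ p₀ ∧ a₁ = Act.write γ₁ ∧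
        p = (p₀, s.2.1, !(!(M₀.isE s.1) && !(M₀.isE p₀)))) ∨
    (s.2.2 = true ∧ ∃ p₁ : M₁.Q, M₁.δ s.2.1 γ₁ a₁ p₁ ∧ a₀ = Act.write γ₀ ∧
        p = (s.1, p₁, M₁.isE s.2.1 && M₁.isE p₁))

end ATMPaper

namespace ATMPaper

variable {C : Type*} {isE : C → Bool} {step : C → C → Prop}

theorem EChain.eq_of_universal {c d : C} (h : EChain isE step c d)
    (hc : isE c = false) : c = d := by
  cases h with
  | refl => rfl
  | step hE _ _ => simp [hc] at hE

theorem UChain.eq_of_existential {c d : C} (h : UChain isE step c d)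
    (hc : isE c = true) : c = d := by
  cases h with
  | refl => rfl
  | step hU _ _ => simp [hc] at hU

theorem rejected_iff_forall_ePivot {c : C} (hc : isE c = true) :
    Rejected isE step c ↔ ∀ d, EPivot isE step c d → Rejected isE step d := by
  refine ⟨fun h => ?_, Rejected.ex hc⟩
  cases h with
  | ex _ h => exact h
  | univ hU _ _ => simp [hc] at hU

theorem rejected_iff_exists_uPivot {c : C} (hc : isE c = false) :
    Rejected isE step c ↔ ∃ d, UPivot isE step c d ∧ Rejected isE step d := by
  refine ⟨fun h => ?_, fun ⟨_, hp, hd⟩ => Rejected.univ hc hp hd⟩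
  cases h with
  | ex hE _ => simp [hc] at hE
  | univ _ hp hd => exact ⟨_, hp, hd⟩

theorem rejected_iff_forall_step {c : C} (hc : isE c = true) :
    Rejected isE step c ↔ ∀ d, step c d → Rejected isE step d := by
  rw [rejected_iff_forall_ePivot hc]
  constructor
  · intro h d hs
    cases hd : isE d with
    | false => exact h d ⟨.step hc hs (.refl d), hd⟩
    | true =>
      exact (rejected_iff_forall_ePivot hd).2 fun e he => h e ⟨.step hc hs he.1, he.2⟩
  · rintro h e ⟨hch, he⟩
    cases hch with
    | refl => simp [hc] at he
    | @step _ d _ _ hs hde =>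
      cases hd : isE d with
      | false => exact hde.eq_of_universal hd ▸ h d hs
      | true => exact (rejected_iff_forall_ePivot hd).1 (h d hs) e ⟨hde, he⟩

theorem rejected_iff_exists_step {c : C} (hc : isE c = false) :
    Rejected isE step c ↔ ∃ d, step c d ∧ Rejected isE step d := by
  rw [rejected_iff_exists_uPivot hc]
  constructor
  · rintro ⟨e, ⟨hch, he⟩, hr⟩
    cases hch with
    | refl => simp [hc] at he
    | @step _ d _ _ hs hde =>
      refine ⟨d, hs, ?_⟩
      cases hd : isE d with
      | false => exact (rejected_iff_exists_uPivot hd).2 ⟨e, ⟨hde, he⟩, hr⟩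
      | true => exact hde.eq_of_existential hd ▸ hr
  · rintro ⟨d, hs, hr⟩
    cases hd : isE d with
    | true => exact ⟨d, ⟨.step hc hs (.refl d), hd⟩, hr⟩
    | false =>
      obtain ⟨e, he, hre⟩ := (rejected_iff_exists_uPivot hd).1 hr
      exact ⟨e, ⟨.step hc hs he.1, he.2⟩, hre⟩

end ATMPaper

open ATMPaper in
/-- if `c` is existential, then `c` is rejected iff every child of
`c` is rejected; if `c` is universal, then `c` is rejected iff some child of
`c` is rejected. -/
theorem stmt2 {α Γ : Type} (M : ATM α Γ) (c : M.Cfg) :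
    (M.cfgE c = true →
      (M.Rejected c ↔ ∀ c' : M.Cfg, M.Yield c c' → M.Rejected c')) ∧
    (M.cfgE c = false →
      (M.Rejected c ↔ ∃ c' : M.Cfg, M.Yield c c' ∧ M.Rejected c')) := by
  exact ⟨rejected_iff_forall_step, rejected_iff_exists_step⟩
end

section
/- If a configuration c of an alternating Turing machine M is neither accepted nor rejected, then there is an infinite sequence c = d₀, d₁, d₂, … of configurations such that for every i, dᵢ₊₁ is an alternation-pivot of dᵢ (i.e., dᵢ ⇑∃ dᵢ₊₁ if dᵢ is existential and dᵢ ⇑∀ dᵢ₊₁ if dᵢ is universal), and moreover each dᵢ is neither accepted nor rejected. -/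
/-- A configuration that is neither accepted nor rejected has an alternation-pivot
that is neither accepted nor rejected. -/
theorem ATMPaper.exists_undecided_pivot {C : Type*} (isE : C → Bool) (step : C → C → Prop)
    {c : C} (hna : ¬Accepted isE step c) (hnr : ¬Rejected isE step c) :
    ∃ c', (isE c = true → EPivot isE step c c') ∧ (isE c = false → UPivot isE step c c') ∧
      ¬Accepted isE step c' ∧ ¬Rejected isE step c' := by
  cases hc : isE c with
  | true =>
    obtain ⟨c', hp, hr⟩ : ∃ c', EPivot isE step c c' ∧ ¬Rejected isE step c' := by
      by_contra! h
      exact hnr (.ex hc h)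
    exact ⟨c', fun _ => hp, nofun, fun ha => hna (.ex hc hp ha), hr⟩
  | false =>
    obtain ⟨c', hp, ha⟩ : ∃ c', UPivot isE step c c' ∧ ¬Accepted isE step c' := by
      by_contra! h
      exact hna (.univ hc h)
    exact ⟨c', nofun, fun _ => hp, ha, fun hr => hnr (.univ hc hp hr)⟩

open ATMPaper in
/-- if a configuration `c` is neither accepted nor rejected, then
there is an infinite sequence `c = d₀, d₁, d₂, …` in which each `dᵢ₊₁` is an
alternation-pivot of `dᵢ`, and each `dᵢ` is neither accepted nor rejected. -/
theorem stmt3 {α Γ : Type} (M : ATM α Γ) (c : M.Cfg)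
    (hna : ¬M.Accepted c) (hnr : ¬M.Rejected c) :
    ∃ d : ℕ → M.Cfg, d 0 = c ∧ ∀ i : ℕ,
      (M.cfgE (d i) = true → M.EPiv (d i) (d (i + 1))) ∧
      (M.cfgE (d i) = false → M.UPiv (d i) (d (i + 1))) ∧
      ¬M.Accepted (d i) ∧ ¬M.Rejected (d i) := by
  choose! next hE hU hA hR using fun (x : M.Cfg) (ha : ¬M.Accepted x) (hr : ¬M.Rejected x) =>
    exists_undecided_pivot M.cfgE M.Yield ha hr
  have h (i : ℕ) : ¬M.Accepted (next^[i] c) ∧ ¬M.Rejected (next^[i] c) := by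
    induction i with
    | zero => exact ⟨hna, hnr⟩
    | succ i ih =>
      rw [Function.iterate_succ_apply']
      exact ⟨hA _ ih.1 ih.2, hR _ ih.1 ih.2⟩
  refine ⟨fun i => next^[i] c, rfl, fun i => ?_⟩
  simp only [Function.iterate_succ_apply']
  exact ⟨hE _ (h i).1 (h i).2, hU _ (h i).1 (h i).2, h i⟩
end

section
/- If an alternating Turing machine M is alternation well-founded, then M is total, i.e., every input string w ∈ Σ* is either accepted or rejected by M. -/
namespace ATMPaper

section Determinacy

variable {C : Type*} (isE : C → Bool) (step : C → C → Prop)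

/-- A configuration that is neither accepted nor rejected. -/
def Undetermined (c : C) : Prop := ¬ Accepted isE step c ∧ ¬ Rejected isE step c

/-- Exactly `n + 1` steps lead from `c` to an undetermined configuration of the opposite type,
all configurations before the last one having the type of `c`. -/
def PivotsIn : ℕ → C → Prop
  | 0, c => ∃ c', step c c' ∧ isE c ≠ isE c' ∧ Undetermined isE step c'
  | n + 1, c => ∃ c', step c c' ∧ isE c = isE c' ∧ PivotsIn n c'

variable {isE step}

theorem EChain.exists_pivotsIn {c c' : C} (h : EChain isE step c c') (hc : isE c = true)
    (hc' : isE c' = false) (hu : Undetermined isE step c') : ∃ n, PivotsIn isE step n c := by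
  induction h with
  | refl c => simp [hc] at hc'
  | @step c c₁ c' _ hs hch ih =>
    by_cases h₁ : isE c₁ = true
    · obtain ⟨n, hn⟩ := ih h₁ hc' hu
      exact ⟨n + 1, c₁, hs, hc.trans h₁.symm, hn⟩
    · cases hch with
      | refl => exact ⟨0, c₁, hs, by simp [hc, hc'], hu⟩
      | step h₂ => exact absurd h₂ h₁

theorem UChain.exists_pivotsIn {c c' : C} (h : UChain isE step c c') (hc : isE c = false)
    (hc' : isE c' = true) (hu : Undetermined isE step c') : ∃ n, PivotsIn isE step n c := by
  induction h with
  | refl c => simp [hc] at hc'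
  | @step c c₁ c' _ hs hch ih =>
    by_cases h₁ : isE c₁ = false
    · obtain ⟨n, hn⟩ := ih h₁ hc' hu
      exact ⟨n + 1, c₁, hs, hc.trans h₁.symm, hn⟩
    · cases hch with
      | refl => exact ⟨0, c₁, hs, by simp [hc, hc'], hu⟩
      | step h₂ => exact absurd h₂ h₁

theorem Undetermined.exists_pivotsIn {c : C} (h : Undetermined isE step c) :
    ∃ n, PivotsIn isE step n c := by
  obtain ⟨hA, hR⟩ := h
  cases hc : isE c with
  | true =>
    obtain ⟨c', hp, hR'⟩ : ∃ c', EPivot isE step c c' ∧ ¬ Rejected isE step c' := by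
      by_contra! hall
      exact hR (.ex hc hall)
    exact hp.1.exists_pivotsIn hc hp.2 ⟨fun hA' => hA (.ex hc hp hA'), hR'⟩
  | false =>
    obtain ⟨c', hp, hA'⟩ : ∃ c', UPivot isE step c c' ∧ ¬ Accepted isE step c' := by
      by_contra! hall
      exact hA (.univ hc hall)
    exact hp.1.exists_pivotsIn hc hp.2 ⟨hA', fun hR' => hR (.univ hc hp hR')⟩

theorem PivotsIn.exists_next {n : ℕ} {c : C} (h : PivotsIn isE step n c) :
    ∃ c' n', PivotsIn isE step n' c' ∧ step c c' ∧ (isE c = isE c' → n' < n) := by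
  cases n with
  | zero =>
    obtain ⟨c', hs, hne, hu⟩ := h
    obtain ⟨m, hm⟩ := hu.exists_pivotsIn
    exact ⟨c', m, hm, hs, fun he => absurd he hne⟩
  | succ n =>
    obtain ⟨c', hs, -, hn⟩ := h
    exact ⟨c', n, hn, hs, fun _ => n.lt_succ_self⟩

/-- From an undetermined configuration there is an infinite run which alternates infinitely
often. -/
theorem Undetermined.exists_alternating_run {c : C} (h : Undetermined isE step c) :
    ∃ d : ℕ → C, d 0 = c ∧ (∀ i, step (d i) (d (i + 1))) ∧
      ∀ n, ∃ m, n ≤ m ∧ isE (d m) ≠ isE (d (m + 1)) := by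
  obtain ⟨n₀, h₀⟩ := h.exists_pivotsIn
  have key (p : {p : C × ℕ // PivotsIn isE step p.2 p.1}) :
      ∃ q : {p : C × ℕ // PivotsIn isE step p.2 p.1},
        step p.1.1 q.1.1 ∧ (isE p.1.1 = isE q.1.1 → q.1.2 < p.1.2) := by
    obtain ⟨c', n', h', hs⟩ := p.2.exists_next
    exact ⟨⟨(c', n'), h'⟩, hs⟩
  choose f hstep hlt using key
  let s (i : ℕ) := f^[i] ⟨(c, n₀), h₀⟩
  have hs (i : ℕ) : s (i + 1) = f (s i) := Function.iterate_succ_apply' ..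
  refine ⟨fun i => (s i).1.1, rfl, fun i => by simpa only [hs] using hstep (s i), fun n => ?_⟩
  by_contra! hall
  have hdec (k : ℕ) : (s (n + k)).1.2 + k ≤ (s n).1.2 := by
    induction k with
    | zero => simp
    | succ k ih =>
      have := hlt (s (n + k)) (by simpa only [hs] using hall (n + k) (n.le_add_right k))
      rw [← hs] at this
      rw [← add_assoc n k 1]
      omega
  have := hdec ((s n).1.2 + 1)
  omega

end Determinacy

end ATMPaper

open ATMPaper in
/-- if an alternating Turing machine `M` is alternation
well-founded, then `M` is total: every input is accepted or rejected. -/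
theorem stmt4 {α Γ : Type} (M : ATM α Γ) (h : M.AltWF) : M.Total := by
  intro w
  by_contra hw
  exact h w (Undetermined.exists_alternating_run (not_or.mp hw))
end

section
/- For every alternating Turing machine M over Σ there exists an alternating Turing machine M⁺ over Σ such that L(M⁺) = L(M) and M⁺ has no rejected configurations at all; in particular L̄(M⁺) = ∅, so M⁺ is one-sided. -/
namespace ATMPaper.ATM

variable {α Γ : Type} (M : ATM α Γ)

/-- The machine `M` extended by a universal state `inr false` and an existential state `inr true`
that yield to each other forever, where every existential state of `M` may also pass to
`inr false`. -/
def addLoop : ATM α Γ where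
  ΓFin := M.ΓFin
  emb := M.emb
  blank := M.blank
  blank_ne := M.blank_ne
  Q := M.Q ⊕ Bool
  QFin := by have := M.QFin; infer_instance
  isE := Sum.elim M.isE id
  start := Sum.inl M.start
  δ := fun s γ a s' =>
    match s, s' with
    | Sum.inl q, Sum.inl q' => M.δ q γ a q'
    | Sum.inl q, Sum.inr b => M.isE q = true ∧ b = false ∧ a = Act.write γ
    | Sum.inr b, Sum.inr b' => b' = !b ∧ a = Act.write γ
    | Sum.inr _, Sum.inl _ => False

/-- A configuration of `M`, seen as a configuration of `M.addLoop`. -/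
def liftCfg (c : M.Cfg) : M.addLoop.Cfg := (Sum.inl c.1, c.2)

variable {M}

theorem addLoop_yield_inr (s : M.addLoop.Q) (b : Bool) (t : Tape Γ)
    (h : M.addLoop.δ s (Tape.scan t) (Act.write (Tape.scan t)) (Sum.inr b)) :
    M.addLoop.Yield (s, t) (Sum.inr b, t) :=
  ⟨_, h, ActStep.write t.1 t.2.1 t.2.1 t.2.2⟩

theorem liftCfg_injective : Function.Injective M.liftCfg := fun _ _ h =>
  Prod.ext (Sum.inl_injective (congrArg Prod.fst h)) (congrArg (fun d => d.2) h)

theorem addLoop_yield_liftCfg {c c' : M.Cfg} :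
    M.addLoop.Yield (M.liftCfg c) (M.liftCfg c') ↔ M.Yield c c' :=
  Iff.rfl

theorem eChain_liftCfg {c c' : M.Cfg} (h : EChain M.cfgE M.Yield c c') :
    EChain M.addLoop.cfgE M.addLoop.Yield (M.liftCfg c) (M.liftCfg c') := by
  induction h with
  | refl c => exact .refl _
  | step hE hs _ ih => exact .step hE (addLoop_yield_liftCfg.2 hs) ih

theorem uChain_liftCfg {c c' : M.Cfg} (h : UChain M.cfgE M.Yield c c') :
    UChain M.addLoop.cfgE M.addLoop.Yield (M.liftCfg c) (M.liftCfg c') := by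
  induction h with
  | refl c => exact .refl _
  | step hE hs _ ih => exact .step hE (addLoop_yield_liftCfg.2 hs) ih

/-- An existential chain ending in a configuration of `M` stays in `M`. -/
theorem exists_of_eChain_addLoop {d d' : M.addLoop.Cfg}
    (h : EChain M.addLoop.cfgE M.addLoop.Yield d d') (c' : M.Cfg) (hc' : d' = M.liftCfg c') :
    ∃ c, d = M.liftCfg c ∧ EChain M.cfgE M.Yield c c' := by
  induction h with
  | refl d => exact ⟨c', hc', .refl _⟩
  | @step d e d' hE hs _ ih =>
    obtain ⟨c, rfl, h⟩ := ih hc'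
    obtain ⟨q | b, t⟩ := d
    · exact ⟨(q, t), rfl, .step hE hs h⟩
    · exact hs.choose_spec.1.elim

/-- A universal chain from a configuration of `M` stays in `M`. -/
theorem exists_of_uChain_addLoop {d d' : M.addLoop.Cfg}
    (h : UChain M.addLoop.cfgE M.addLoop.Yield d d') (c : M.Cfg) (hc : d = M.liftCfg c) :
    ∃ c', d' = M.liftCfg c' ∧ UChain M.cfgE M.Yield c c' := by
  induction h generalizing c with
  | refl d => exact ⟨c, hc, .refl _⟩
  | @step d e d' hE hs _ ih =>
    subst hc
    obtain ⟨p | b, t⟩ := e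
    · obtain ⟨c', rfl, h⟩ := ih (p, t) rfl
      exact ⟨c', rfl, .step (c' := (p, t)) hE hs h⟩
    · obtain ⟨a, ⟨h, -⟩, -⟩ := hs
      exact absurd (hE.symm.trans h) Bool.false_ne_true

theorem accepted_liftCfg {c : M.Cfg} (h : M.Accepted c) :
    M.addLoop.Accepted (M.liftCfg c) := by
  induction h with
  | ex hE hp _ ih => exact .ex hE ⟨eChain_liftCfg hp.1, hp.2⟩ ih
  | univ hE _ ih =>
    refine .univ hE fun d hd => ?_
    obtain ⟨c', rfl, h⟩ := exists_of_uChain_addLoop hd.1 _ rfl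
    exact ih c' ⟨h, hd.2⟩

theorem exists_of_accepted_addLoop {d : M.addLoop.Cfg} (h : M.addLoop.Accepted d) :
    ∃ c, d = M.liftCfg c ∧ M.Accepted c := by
  induction h with
  | @ex d d' hE hp _ ih =>
    obtain ⟨c', rfl, hc'⟩ := ih
    obtain ⟨c, rfl, h⟩ := exists_of_eChain_addLoop hp.1 c' rfl
    exact ⟨c, rfl, .ex hE ⟨h, hp.2⟩ hc'⟩
  | @univ d hE _ ih =>
    obtain ⟨q | b, t⟩ := d
    · refine ⟨(q, t), rfl, .univ hE fun c' hc' => ?_⟩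
      obtain ⟨c, hc, h⟩ := ih (M.liftCfg c') ⟨uChain_liftCfg hc'.1, hc'.2⟩
      exact liftCfg_injective hc ▸ h
    · obtain rfl : b = false := hE
      obtain ⟨c, hc, -⟩ := ih (Sum.inr true, t)
        ⟨.step rfl (addLoop_yield_inr _ _ _ ⟨rfl, rfl⟩) (.refl _), rfl⟩
      cases hc

theorem not_rejected_addLoop (d : M.addLoop.Cfg) : ¬M.addLoop.Rejected d := by
  intro h
  induction h with
  | @ex d hE _ ih =>
    refine ih (Sum.inr false, d.2) ⟨.step hE (addLoop_yield_inr d.1 _ _ ?_) (.refl _), rfl⟩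
    obtain ⟨q | b, t⟩ := d
    · exact ⟨hE, rfl, rfl⟩
    · obtain rfl : b = true := hE
      exact ⟨rfl, rfl⟩
  | univ _ _ _ ih => exact ih

theorem lang_addLoop : M.addLoop.Lang = M.Lang := by
  ext w
  refine ⟨fun h => ?_, fun h => accepted_liftCfg h⟩
  obtain ⟨c, hc, h⟩ := exists_of_accepted_addLoop h
  obtain rfl : M.init w = c := liftCfg_injective hc
  exact h

end ATMPaper.ATM

open ATMPaper in
/-- for every ATM `M` over `Σ` there is an ATM `M⁺` over `Σ` with
`L(M⁺) = L(M)` and no rejected configurations at all; in particular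
`L̄(M⁺) = ∅`, so `M⁺` is one-sided. -/
theorem stmt7 {α Γ : Type} (M : ATM α Γ) :
    ∃ (Γ' : Type) (M' : ATM α Γ'), M'.Lang = M.Lang ∧
      (∀ c : M'.Cfg, ¬M'.Rejected c) ∧ M'.coLang = ∅ ∧ M'.OneSided := by
  have hco : M.addLoop.coLang = ∅ :=
    Set.eq_empty_of_forall_notMem fun _ => ATM.not_rejected_addLoop _
  exact ⟨Γ, M.addLoop, ATM.lang_addLoop, ATM.not_rejected_addLoop, hco,
    .inr ATM.not_rejected_addLoop⟩
end

section
/- For every alternating Turing machine M over Σ there exists an alternating Turing machine M⁻ over Σ such that L̄(M⁻) = L̄(M) and M⁻ has no accepted configurations at all; in particular L(M⁻) = ∅, so M⁻ is one-sided. -/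
namespace ATMPaper.ATM

variable {α Γ : Type} (M : ATM α Γ)

/-- `M` extended by two states `Sum.inr true` (existential) and `Sum.inr false` (universal) that
alternate forever, the first of which can be entered from every universal state of `M`. -/
def withAlternatingSink : ATM α Γ where
  ΓFin := M.ΓFin
  emb := M.emb
  blank := M.blank
  blank_ne := M.blank_ne
  Q := M.Q ⊕ Bool
  QFin := by have := M.QFin; infer_instance
  isE := Sum.elim M.isE id
  start := Sum.inl M.start
  δ
    | Sum.inl q, γ, a, Sum.inl q' => M.δ q γ a q'
    | Sum.inl q, γ, a, Sum.inr b => M.isE q = false ∧ b = true ∧ a = Act.write γ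
    | Sum.inr b, γ, a, Sum.inr b' => b' = !b ∧ a = Act.write γ
    | Sum.inr _, _, _, Sum.inl _ => False

/-- A configuration of `M` as a configuration of `M.withAlternatingSink`. -/
def sinkLift (c : M.Cfg) : M.withAlternatingSink.Cfg := (Sum.inl c.1, c.2)

variable {M}

lemma sinkLift_injective : Function.Injective M.sinkLift := by
  rintro ⟨q, t⟩ ⟨q', t'⟩ h
  obtain ⟨h₁, h₂⟩ := Prod.mk.inj h
  exact Prod.ext (Sum.inl_injective h₁) h₂

lemma yield_sinkLift_iff {c d : M.Cfg} :
    M.withAlternatingSink.Yield (M.sinkLift c) (M.sinkLift d) ↔ M.Yield c d :=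
  Iff.rfl

lemma exists_sinkLift_of_yield_ex {c : M.Cfg} {d' : M.withAlternatingSink.Cfg}
    (hc : M.cfgE c = true) (h : M.withAlternatingSink.Yield (M.sinkLift c) d') :
    ∃ d, d' = M.sinkLift d ∧ M.Yield c d := by
  obtain ⟨q' | b, t'⟩ := d'
  · exact ⟨(q', t'), rfl, h⟩
  · obtain ⟨a, h, -⟩ := h
    exact absurd (hc.symm.trans h.1) (by simp)

lemma exists_sinkLift_of_yield_sinkLift {c' : M.withAlternatingSink.Cfg} {d : M.Cfg}
    (h : M.withAlternatingSink.Yield c' (M.sinkLift d)) :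
    ∃ c, c' = M.sinkLift c ∧ M.Yield c d := by
  obtain ⟨q | b, t⟩ := c'
  · exact ⟨(q, t), rfl, h⟩
  · obtain ⟨a, h, -⟩ := h
    exact h.elim

lemma eChain_sinkLift {c d : M.Cfg} (h : EChain M.cfgE M.Yield c d) :
    EChain M.withAlternatingSink.cfgE M.withAlternatingSink.Yield
      (M.sinkLift c) (M.sinkLift d) := by
  induction h with
  | refl c => exact .refl _
  | step hc hs _ ih => exact .step hc (yield_sinkLift_iff.2 hs) ih

lemma uChain_sinkLift {c d : M.Cfg} (h : UChain M.cfgE M.Yield c d) :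
    UChain M.withAlternatingSink.cfgE M.withAlternatingSink.Yield
      (M.sinkLift c) (M.sinkLift d) := by
  induction h with
  | refl c => exact .refl _
  | step hc hs _ ih => exact .step hc (yield_sinkLift_iff.2 hs) ih

lemma exists_sinkLift_of_eChain {c' d' : M.withAlternatingSink.Cfg}
    (h : EChain M.withAlternatingSink.cfgE M.withAlternatingSink.Yield c' d') :
    ∀ c, c' = M.sinkLift c → ∃ d, d' = M.sinkLift d ∧ EChain M.cfgE M.Yield c d := by
  induction h with
  | refl c' => exact fun c hc => ⟨c, hc, .refl _⟩
  | step he hs _ ih =>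
    rintro c rfl
    obtain ⟨e, rfl, hce⟩ := exists_sinkLift_of_yield_ex (M := M) he hs
    obtain ⟨d, rfl, hed⟩ := ih e rfl
    exact ⟨d, rfl, .step he hce hed⟩

lemma exists_sinkLift_of_uChain {c' d' : M.withAlternatingSink.Cfg}
    (h : UChain M.withAlternatingSink.cfgE M.withAlternatingSink.Yield c' d') :
    ∀ d, d' = M.sinkLift d → ∃ c, c' = M.sinkLift c ∧ UChain M.cfgE M.Yield c d := by
  induction h with
  | refl c' => exact fun d hd => ⟨d, hd, .refl _⟩
  | step he hs _ ih =>
    rintro d rfl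
    obtain ⟨e, rfl, hed⟩ := ih d rfl
    obtain ⟨c, rfl, hce⟩ := exists_sinkLift_of_yield_sinkLift hs
    exact ⟨c, rfl, .step he hce hed⟩

lemma Rejected.sinkLift {c : M.Cfg} (h : M.Rejected c) :
    M.withAlternatingSink.Rejected (M.sinkLift c) := by
  induction h with
  | ex hc _ ih =>
    refine .ex hc ?_
    rintro d' ⟨hd', hu⟩
    obtain ⟨d, rfl, hd⟩ := exists_sinkLift_of_eChain hd' _ rfl
    exact ih d ⟨hd, hu⟩
  | univ hc hp _ ih => exact .univ hc ⟨uChain_sinkLift hp.1, hp.2⟩ ih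

lemma exists_sinkLift_of_rejected {c' : M.withAlternatingSink.Cfg}
    (h : M.withAlternatingSink.Rejected c') : ∃ c, c' = M.sinkLift c ∧ M.Rejected c := by
  induction h with
  | @ex c' hc' _ ih =>
    obtain ⟨q | b, t⟩ := c'
    · refine ⟨(q, t), rfl, .ex hc' fun d hd => ?_⟩
      obtain ⟨e, he, hr⟩ := ih (M.sinkLift d) ⟨eChain_sinkLift hd.1, hd.2⟩
      exact sinkLift_injective he ▸ hr
    · obtain rfl : b = true := hc'
      have hs : M.withAlternatingSink.Yield (Sum.inr true, t) (Sum.inr false, t) :=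
        ⟨.write t.2.1, ⟨rfl, rfl⟩, .write _ _ _ _⟩
      obtain ⟨e, he, -⟩ := ih (Sum.inr false, t) ⟨.step rfl hs (.refl _), rfl⟩
      exact absurd (congrArg Prod.fst he) Sum.inr_ne_inl
  | univ hc' hp _ ih =>
    obtain ⟨d, rfl, hd⟩ := ih
    obtain ⟨c, rfl, hcd⟩ := exists_sinkLift_of_uChain hp.1 d rfl
    exact ⟨c, rfl, .univ hc' ⟨hcd, hp.2⟩ hd⟩

lemma rejected_sinkLift_iff {c : M.Cfg} :
    M.withAlternatingSink.Rejected (M.sinkLift c) ↔ M.Rejected c := by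
  refine ⟨fun h => ?_, Rejected.sinkLift⟩
  obtain ⟨e, he, hr⟩ := exists_sinkLift_of_rejected h
  exact sinkLift_injective he ▸ hr

lemma yield_sink {c' : M.withAlternatingSink.Cfg}
    (hc' : M.withAlternatingSink.cfgE c' = false) :
    M.withAlternatingSink.Yield c' (Sum.inr true, c'.2) := by
  obtain ⟨q | b, t⟩ := c'
  · exact ⟨.write t.2.1, ⟨hc', rfl, rfl⟩, .write _ _ _ _⟩
  · obtain rfl : b = false := hc'
    exact ⟨.write t.2.1, ⟨rfl, rfl⟩, .write _ _ _ _⟩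

lemma not_accepted_withAlternatingSink (c' : M.withAlternatingSink.Cfg) :
    ¬M.withAlternatingSink.Accepted c' := by
  intro h
  induction h with
  | ex _ _ _ ih => exact ih
  | univ hc' _ ih => exact ih _ ⟨.step hc' (yield_sink hc') (.refl _), rfl⟩

lemma coLang_withAlternatingSink : M.withAlternatingSink.coLang = M.coLang :=
  Set.ext fun w => rejected_sinkLift_iff (c := M.init w)

end ATMPaper.ATM

open ATMPaper in
/-- for every ATM `M` over `Σ` there is an ATM `M⁻` over `Σ` with
`L̄(M⁻) = L̄(M)` and no accepted configurations at all; in particular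
`L(M⁻) = ∅`, so `M⁻` is one-sided. -/
theorem stmt8 {α Γ : Type} (M : ATM α Γ) :
    ∃ (Γ' : Type) (M' : ATM α Γ'), M'.coLang = M.coLang ∧
      (∀ c : M'.Cfg, ¬M'.Accepted c) ∧ M'.Lang = ∅ ∧ M'.OneSided := by
  refine ⟨Γ, M.withAlternatingSink, ATM.coLang_withAlternatingSink,
    ATM.not_accepted_withAlternatingSink, ?_, Or.inl ATM.not_accepted_withAlternatingSink⟩
  exact Set.eq_empty_of_forall_notMem fun w => ATM.not_accepted_withAlternatingSink _
end

section
/- A language L ⊆ Σ* is Σ⁰₁ (computably enumerable) if and only if L = L(M) for some Σ₁ alternating Turing machine M. -/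
namespace ATMPaper

open Turing Turing.PartrecToTM2 Turing.ToPartrec

/-- The tape alphabet of Mathlib's one-tape emulation of partial recursive codes. -/
abbrev CodeSym : Type := TM2to1.Γ' K' (fun _ => PartrecToTM2.Γ')

instance : Finite K' :=
  Finite.of_injective
    (fun k => match k with
      | K'.main => (0 : Fin 4)
      | K'.rev => 1
      | K'.aux => 2
      | K'.stack => 3)
    (by intro a b h; cases a <;> cases b <;> simp_all)

instance : Finite CodeSym := by
  unfold CodeSym TM2to1.Γ'; infer_instance

/-- Restricting a `TM0` machine to a set of states supporting it does not affect halting. -/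
theorem exists_TM0_on_support {Γ Λ : Type} [Inhabited Γ] [Inhabited Λ] (T : TM0.Machine Γ Λ)
    {S : Set Λ} (hS : S.Finite) (ss : TM0.Supports T S) :
    ∃ (Λ' : Type) (_ : Inhabited Λ') (_ : Finite Λ') (T' : TM0.Machine Γ Λ'),
      ∀ l, (TM0.eval T' l).Dom ↔ (TM0.eval T l).Dom := by
  classical
  let _ : Inhabited S := ⟨⟨default, ss.1⟩⟩
  let g : PointedMap Λ S := ⟨fun q => if h : q ∈ S then ⟨q, h⟩ else default, by simp [ss.1]; rfl⟩
  have hg : ∀ q (h : q ∈ S), g q = ⟨q, h⟩ := fun q h => dif_pos h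
  refine ⟨S, inferInstance, hS, T.map ⟨_root_.id, rfl⟩ ⟨_root_.id, rfl⟩ g Subtype.val, fun l => ?_⟩
  have H := TM0.Machine.map_respects T ⟨_root_.id, rfl⟩ ⟨_root_.id, rfl⟩ g Subtype.val ss
    (fun _ => rfl) (fun q hq => by rw [hg q hq])
  have e := TM0.map_init (⟨_root_.id, rfl⟩ : PointedMap Γ Γ) g l
  rw [show l.map (⟨_root_.id, rfl⟩ : PointedMap Γ Γ) = l from List.map_id l] at e
  exact StateTransition.tr_eval_dom H (a₁ := TM0.init l) ⟨ss.1, e⟩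

theorem exists_TM0_of_code (c : Code) :
    ∃ (Λ : Type) (_ : Inhabited Λ) (_ : Finite Λ) (T : TM0.Machine CodeSym Λ), ∀ v : List ℕ,
      (TM0.eval T (TM2to1.trInit K'.main (trList v))).Dom ↔ (c.eval v).Dom := by
  classical
  let _ : Inhabited PartrecToTM2.Λ' := ⟨trNormal c Cont'.halt⟩
  have h₁ := TM1to0.tr_supports _ (TM2to1.tr_supports PartrecToTM2.tr (tr_supports c Cont'.halt))
  obtain ⟨Λ, i, hf, T, hT⟩ := exists_TM0_on_support _ (Finset.finite_toSet _) h₁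
  refine ⟨Λ, i, hf, T, fun v => (hT _).trans ?_⟩
  rw [TM1to0.tr_eval]
  refine (TM2to1.tr_eval_dom _ _ _).trans ?_
  have hi : TM2.init (Γ := fun _ : K' => PartrecToTM2.Γ') (σ := Option PartrecToTM2.Γ') K'.main
      (trList v) = PartrecToTM2.init c v := by
    unfold TM2.init PartrecToTM2.init
    congr 1
    funext k
    cases k <;> rfl
  have e := PartrecToTM2.tr_eval c v
  change (StateTransition.eval (TM2.step PartrecToTM2.tr)
    (TM2.init (Γ := fun _ : K' => PartrecToTM2.Γ') K'.main (trList v))).Dom ↔ _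
  rw [hi]
  exact Iff.of_eq (congrArg Part.Dom e)

theorem exists_code_unary {f : ℕ →. ℕ} (hf : Partrec f) :
    ∃ c : Code, ∀ n, c.eval [n] = (f n).map fun m => [m] := by
  obtain ⟨c, hc⟩ := Code.exists_code (Nat.Partrec'.part_iff₁.2 hf)
  exact ⟨c, fun n => hc ⟨[n], rfl⟩⟩

theorem exists_code_binary {f : ℕ → ℕ → ℕ} (hf : Computable₂ f) :
    ∃ c : Code, ∀ m n, c.eval [m, n] = Part.some [f m n] := by
  obtain ⟨c, hc⟩ := Code.exists_code (Nat.Partrec'.part_iff₂.2 hf.partrec₂)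
  exact ⟨c, fun m n => (hc ⟨[m, n], rfl⟩).trans (Part.map_some _ _)⟩

theorem code_comp_eval {f g : Code} {u v : List ℕ} (hg : g.eval v = Part.some u) :
    (Code.comp f g).eval v = f.eval u := by
  rw [Code.comp_eval]
  exact (congrArg (fun p => p.bind f.eval) hg).trans (Part.bind_some _ _)

theorem code_cons_eval {f g : Code} {u v w : List ℕ} (hf : f.eval v = Part.some u)
    (hg : g.eval v = Part.some w) : (Code.cons f g).eval v = Part.some (u.headI :: w) := by
  rw [Code.cons_eval]
  change ((f.eval v).bind fun n => (g.eval v).bind fun ns => Part.some (n.headI :: ns)) = _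
  rw [hf, Part.bind_some, hg, Part.bind_some]

theorem code_tail_eval (v : List ℕ) : Code.tail.eval v = Part.some v.tail := by
  rw [Code.tail_eval]; rfl

/-- One round of a loop consuming a list of positive numbers up to a terminating `0`:
the state is the accumulator followed by the rest of the list. -/
def foldBody (g : Code) : Code :=
  .comp (.case (.cons .zero (.cons .head .nil))
      (.cons (.comp .succ .zero) (.cons (.comp g (.cons .head (.cons (.comp .head .tail) .nil)))
        (.comp .tail .tail))))
    (.cons (.comp .head .tail) (.cons .head (.comp .tail .tail)))

theorem foldBody_eval (g : Code) (acc h : ℕ) (v : List ℕ) :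
    (foldBody g).eval (acc :: h :: v) =
      (Code.case (.cons .zero (.cons .head .nil))
        (.cons (.comp .succ .zero) (.cons (.comp g (.cons .head (.cons (.comp .head .tail) .nil)))
          (.comp .tail .tail)))).eval (h :: acc :: v) :=
  code_comp_eval <| code_cons_eval ((code_comp_eval (code_tail_eval _)).trans (Code.head_eval _))
    (code_cons_eval (Code.head_eval _) ((code_comp_eval (code_tail_eval _)).trans
      (code_tail_eval _)))

theorem foldBody_eval_zero (g : Code) (acc : ℕ) (v : List ℕ) :
    (foldBody g).eval (acc :: 0 :: v) = Part.some [0, acc] := by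
  rw [foldBody_eval, Code.case_eval]
  exact code_cons_eval (Code.zero_eval _) (code_cons_eval (Code.head_eval _) (Code.nil_eval _))

theorem foldBody_eval_succ {g : Code} {f : ℕ → ℕ → ℕ}
    (hg : ∀ m n, g.eval [m, n] = Part.some [f m n]) (acc h : ℕ) (v : List ℕ) :
    (foldBody g).eval (acc :: (h + 1) :: v) = Part.some (1 :: f h acc :: v) := by
  rw [foldBody_eval, Code.case_eval]
  have hone : (Code.comp .succ .zero).eval (h :: acc :: v) = Part.some [1] := by
    rw [code_comp_eval (Code.zero_eval _), Code.succ_eval]; rfl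
  have harg := code_cons_eval (Code.head_eval (h :: acc :: v)) <|
    code_cons_eval ((code_comp_eval (code_tail_eval _)).trans (Code.head_eval _))
      (Code.nil_eval (h :: acc :: v))
  exact code_cons_eval hone <| code_cons_eval ((code_comp_eval harg).trans (hg _ _)) <|
    (code_comp_eval (code_tail_eval _)).trans (code_tail_eval _)

theorem fix_foldBody_eval {g : Code} {f : ℕ → ℕ → ℕ}
    (hg : ∀ m n, g.eval [m, n] = Part.some [f m n]) (v : List ℕ) (acc : ℕ) :
    (Code.fix (foldBody g)).eval (acc :: (v.map Nat.succ ++ [0])) =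
      Part.some [v.foldl (fun a h => f h a) acc] := by
  rw [Code.fix_eval]
  induction v generalizing acc with
  | nil =>
    refine Part.eq_some_iff.2 (PFun.mem_fix_iff.2 (Or.inl ?_))
    simp [foldBody_eval_zero]
  | cons h v ih =>
    rw [List.foldl_cons, ← ih]
    apply PFun.fix_fwd_eq
    simp [foldBody_eval_succ hg]

theorem exists_code_of_rePred {α : Type} [Primcodable α] {L : List α → Prop} (hL : REPred L) :
    ∃ c : Code, ∀ w : List α,
      (c.eval (w.reverse.map (fun a => Encodable.encode a + 1) ++ [0])).Dom ↔ L w := by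
  have hp : Partrec fun n : ℕ =>
      (Part.ofOption (Encodable.decode (α := List α) n)).bind fun w =>
        (Part.assert (L w) fun _ => Part.some ()).map fun _ => (0 : ℕ) := by
    refine Partrec.bind (Computable.ofOption Computable.decode) ?_
    exact Partrec.map (hL.comp Computable.snd) (Computable.const 0).to₂
  obtain ⟨d, hd⟩ := exists_code_unary hp
  have hcons : Computable₂ fun m n : ℕ => Nat.succ (Nat.pair m n) :=
    (Primrec.succ.comp Primrec₂.natPair).to_comp
  obtain ⟨g, hg⟩ := exists_code_binary hcons
  refine ⟨.comp d (.comp (.fix (foldBody g)) .zero'), fun w => ?_⟩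
  have hfold : ((w.reverse.map Encodable.encode).foldl
      (fun a h => Nat.succ (Nat.pair h a)) 0) = Encodable.encode w := by
    rw [List.map_reverse, List.foldl_reverse]
    induction w with
    | nil => rfl
    | cons a w ih => rw [List.map_cons, List.foldr_cons, ih]; rfl
  have key := fix_foldBody_eval hg (w.reverse.map Encodable.encode) 0
  rw [hfold, List.map_map] at key
  have key₀ : Code.zero'.eval (w.reverse.map (fun a => Encodable.encode a + 1) ++ [0]) =
      Part.some (0 :: (w.reverse.map (Nat.succ ∘ Encodable.encode) ++ [0])) := by
    rw [Code.zero'_eval]; rfl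
  rw [code_comp_eval ((code_comp_eval key₀).trans key), hd]
  simp [Part.assert]
end ATMPaper

namespace ATMPaper

open Turing

section Halting

variable {α Γ S : Type}

/-- The action of a Turing machine on a cursored tape, as a function. -/
def actFun (blank : Γ) : Act Γ → Tape Γ → Tape Γ
  | .write τ, t => (t.1, τ, t.2.2)
  | .right, t => (t.1 ++ [t.2.1], t.2.2.headD blank, t.2.2.tail)
  | .left, t =>
    match t.1.getLast? with
    | none => t
    | some τ => (t.1.dropLast, τ, t.2.1 :: t.2.2)

theorem actFun_left_append (blank : Γ) (u : List Γ) (τ γ : Γ) (v : List Γ) :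
    actFun blank .left (u ++ [τ], γ, v) = (u, τ, γ :: v) := by
  simp [actFun]

theorem actStep_iff (blank : Γ) (a : Act Γ) (t t' : Tape Γ) :
    ActStep blank a t t' ↔ t' = actFun blank a t := by
  constructor
  · rintro (_ | _ | _ | _ | _) <;> simp [actFun]
  · rintro rfl
    obtain ⟨u, γ, v⟩ := t
    cases a with
    | write τ => exact .write ..
    | right =>
      cases v with
      | nil => exact .fwdEnd ..
      | cons τ v => exact .fwd ..
    | left =>
      rcases List.eq_nil_or_concat u with rfl | ⟨u, τ, rfl⟩
      · exact .bwdEnd ..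
      · rw [List.concat_eq_append, actFun_left_append]
        exact .bwd ..

/-- One step of the deterministic machine with transition function `next`. -/
def detStep (blank : Γ) (next : S → Γ → Option (Act Γ × S)) (c : S × Tape Γ) :
    Option (S × Tape Γ) :=
  (next c.1 c.2.2.1).map fun p => (p.2, actFun blank p.1 c.2)

variable [Finite Γ] [Finite S]

/-- The alternating machine that follows the deterministic transition function `next` in
existential states, and enters its only universal state when `next` halts. -/
def haltATM (emb : α ↪ Γ) (blank : Γ) (hb : ∀ a, emb a ≠ blank) (start : S)
    (next : S → Γ → Option (Act Γ × S)) : ATM α Γ where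
  ΓFin := ‹_›
  emb := emb
  blank := blank
  blank_ne := hb
  Q := Option S
  QFin := inferInstance
  isE := Option.isSome
  start := some start
  δ q γ a q' := match q, q' with
    | some s, some s' => next s γ = some (a, s')
    | some s, none => next s γ = none ∧ a = .write γ
    | none, _ => False

variable {emb : α ↪ Γ} {blank : Γ} {hb : ∀ a, emb a ≠ blank} {start : S}
  {next : S → Γ → Option (Act Γ × S)}

theorem haltATM_yield_some {s s' : S} {t t' : Tape Γ} :
    (haltATM emb blank hb start next).Yield (some s, t) (some s', t') ↔
      detStep blank next (s, t) = some (s', t') := by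
  simp only [ATM.Yield, haltATM, actStep_iff, detStep, Tape.scan, Option.map_eq_some_iff,
    Prod.exists, Prod.mk.injEq]
  constructor
  · rintro ⟨a, h, rfl⟩; exact ⟨a, s', h, rfl, rfl⟩
  · rintro ⟨a, _, h, rfl, rfl⟩; exact ⟨a, h, rfl⟩

theorem haltATM_yield_none {s : S} {t t' : Tape Γ} :
    (haltATM emb blank hb start next).Yield (some s, t) (none, t') ↔
      detStep blank next (s, t) = none ∧ t' = t := by
  simp only [ATM.Yield, haltATM, actStep_iff, detStep, Tape.scan, Option.map_eq_none_iff]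
  constructor
  · rintro ⟨a, ⟨h, rfl⟩, rfl⟩; exact ⟨h, rfl⟩
  · rintro ⟨h, rfl⟩; exact ⟨_, ⟨h, rfl⟩, rfl⟩

theorem haltATM_not_yield {t : Tape Γ} {c : Option S × Tape Γ} :
    ¬ (haltATM emb blank hb start next).Yield (none, t) c := by
  rintro ⟨a, h, -⟩
  exact h

theorem haltATM_not_yield_of_universal {c c' : (haltATM emb blank hb start next).Cfg}
    (hc : (haltATM emb blank hb start next).cfgE c = false) :
    ¬ (haltATM emb blank hb start next).Yield c c' := by
  obtain ⟨_ | s, t⟩ := c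
  · exact haltATM_not_yield
  · exact absurd hc (by simp [ATM.cfgE, haltATM])

theorem haltATM_isSigmaM : (haltATM emb blank hb start next).IsSigmaM 1 := by
  refine ⟨rfl, fun w n d _ hd => Finset.card_le_one.2 ?_⟩
  have key : ∀ i j, i < j → j < n →
      (haltATM emb blank hb start next).cfgE (d i) ≠
        (haltATM emb blank hb start next).cfgE (d (i + 1)) → False := by
    intro i j hij hj hne
    have h₀ : (haltATM emb blank hb start next).cfgE (d i) = true := by
      by_contra h
      exact haltATM_not_yield_of_universal (Bool.eq_false_of_not_eq_true h) (hd i (by omega))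
    have h₁ : (haltATM emb blank hb start next).cfgE (d (i + 1)) = false := by
      rw [h₀] at hne
      exact Bool.eq_false_of_not_eq_true (Ne.symm hne)
    exact haltATM_not_yield_of_universal h₁ (hd (i + 1) (by omega))
  intro i hi j hj
  simp only [Finset.mem_filter, Finset.mem_range] at hi hj
  rcases lt_trichotomy i j with h | h | h
  · exact (key i j h hj.1 hi.2).elim
  · exact h
  · exact (key j i h hi.1 hj.2).elim

theorem haltATM_accepts_iff (w : List α) :
    (haltATM emb blank hb start next).Accepts w ↔
      (StateTransition.eval (detStep blank next) (start, ([], blank, w.map emb))).Dom := by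
  set M := haltATM emb blank hb start next with hM
  have hacc : ∀ t : Tape Γ, M.Accepted (none, t) := fun t => by
    refine .univ rfl fun c' hc' => ?_
    obtain ⟨h, h'⟩ := hc'
    cases h with
    | refl => cases h'
    | step _ hy _ => exact (haltATM_not_yield hy).elim
  constructor
  · intro h
    have key : ∀ c c' : M.Cfg, EChain M.cfgE M.Yield c c' → M.cfgE c' = false →
        ∀ s, c.1 = some s → (StateTransition.eval (detStep blank next) (s, c.2)).Dom := by
      intro c c' hc hc'
      induction hc with
      | refl c => 
        intro s hs
        obtain ⟨q, t⟩ := c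
        obtain rfl : q = some s := hs
        cases hc'
      | @step c₁ c₂ c₃ _ hy _ ih =>
        intro s hs
        obtain ⟨q₁, t₁⟩ := c₁
        obtain ⟨_ | s₂, t₂⟩ := c₂ <;> obtain rfl : q₁ = some s := hs
        · obtain ⟨h, rfl⟩ := haltATM_yield_none.1 hy
          exact Part.dom_iff_mem.2 ⟨_, StateTransition.mem_eval.2 ⟨.refl, h⟩⟩
        · have h := haltATM_yield_some.1 hy
          rw [StateTransition.reaches_eval (Relation.ReflTransGen.single h)]
          exact ih hc' s₂ rfl
    cases h with
    | ex _ hp _ => exact key _ _ hp.1 hp.2 _ rfl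
    | univ h _ => cases h
  · intro h
    obtain ⟨b, hb⟩ := Part.dom_iff_mem.1 h
    obtain ⟨hr, hn⟩ := StateTransition.mem_eval.1 hb
    have key : ∀ c : S × Tape Γ, StateTransition.Reaches (detStep blank next) c b →
        EChain M.cfgE M.Yield (some c.1, c.2) (none, b.2) := fun c hc => by
      induction hc using Relation.ReflTransGen.head_induction_on with
      | refl => exact .step rfl (haltATM_yield_none.2 ⟨hn, rfl⟩) (.refl _)
      | head h' _ ih => exact .step rfl (haltATM_yield_some.2 h') ih
    exact .ex rfl ⟨key _ hr, rfl⟩ (hacc _)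

end Halting

theorem listBlank_mk_append_replicate {Γ₀ : Type} [Inhabited Γ₀] (l : List Γ₀) (n : ℕ) :
    ListBlank.mk (l ++ List.replicate n default) = ListBlank.mk l :=
  (Quotient.sound' (Or.inl ⟨n, rfl⟩)).symm

section Folding

variable {α Γ₀ Λ : Type} {B : ℕ}

/-- Nonempty words of length at most `B + 1`. -/
abbrev Word (Γ₀ : Type) (B : ℕ) : Type := {l : List Γ₀ // l ≠ [] ∧ l.length ≤ B + 1}

instance [Finite Γ₀] : Finite (Word Γ₀ B) :=
  ((List.finite_length_le Γ₀ (B + 1)).subset fun _ h => h.2).to_subtype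

/-- The word `w` with its `k`-th letter replaced by `x`. -/
def Word.set (w : Word Γ₀ B) (k : ℕ) (x : Γ₀) : Word Γ₀ B :=
  ⟨w.1.set k x, by simp [w.2.1], by simp [w.2.2]⟩

/-- The alphabet of the folded machine: blanks, input letters, and cells consisting of a
mark for the left end of the tape, a word of the right half of the simulated tape and a letter of
its left half. -/
abbrev FoldSym (α Γ₀ : Type) (B : ℕ) : Type := Option α ⊕ (Bool × Word Γ₀ B × Γ₀)

namespace FoldSym

/-- Whether the cell is marked as the left end of the tape. -/
def flag : FoldSym α Γ₀ B → Bool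
  | .inl _ => false
  | .inr c => c.1

variable [Inhabited Γ₀] (block : α → Word Γ₀ B)

/-- The word of the right half of the simulated tape held by a cell. -/
def up : FoldSym α Γ₀ B → Word Γ₀ B
  | .inl none => ⟨[default], by simp⟩
  | .inl (some a) => block a
  | .inr c => c.2.1

/-- The letter of the left half of the simulated tape held by a cell. -/
def low : FoldSym α Γ₀ B → Γ₀
  | .inl _ => default
  | .inr c => c.2.2

end FoldSym

/-- States of the folded machine: `top q p` simulates `q` at position `p` of the word held by the
scanned cell, and `bot q` simulates `q` on the left half of the tape. -/
inductive FoldState (Λ : Type) (B : ℕ) : Type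
  | start
  | top (q : Λ) (p : Fin (B + 1))
  | bot (q : Λ)

instance [Finite Λ] : Finite (FoldState Λ B) :=
  Finite.of_surjective
    (fun s : Unit ⊕ (Λ × Fin (B + 1)) ⊕ Λ => match s with
      | .inl _ => .start
      | .inr (.inl p) => .top p.1 p.2
      | .inr (.inr q) => .bot q)
    fun s => match s with
      | .start => ⟨.inl (), rfl⟩
      | .top q p => ⟨.inr (.inl (q, p)), rfl⟩
      | .bot q => ⟨.inr (.inr q), rfl⟩

/-- The number `k`, truncated to the range of positions in a word. -/
def clip (B k : ℕ) : Fin (B + 1) := ⟨min k B, by omega⟩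

/-- The position in the word `w` that is indicated by `p`. -/
def Word.pos (w : Word Γ₀ B) (p : Fin (B + 1)) : ℕ := min p (w.1.length - 1)

theorem Word.pos_clip {w : Word Γ₀ B} {k : ℕ} (hk : k < w.1.length) : w.pos (clip B k) = k := by
  have := w.2.2
  simp only [pos, clip]
  omega

theorem Word.pos_clip_last (w : Word Γ₀ B) : w.pos (clip B B) = w.1.length - 1 := by
  have := w.2.2
  simp only [pos, clip]
  omega

open FoldSym in
/-- The transition function of the folded machine. -/
def foldNext [Inhabited Γ₀] [Inhabited Λ] (T : TM0.Machine Γ₀ Λ) (first : Γ₀)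
    (block : α → Word Γ₀ B) :
    FoldState Λ B → FoldSym α Γ₀ B → Option (Act (FoldSym α Γ₀ B) × FoldState Λ B)
  | .start, _ => some (.write (.inr (true, ⟨[first], by simp⟩, default)), .top default (clip B 0))
  | .top q p, γ =>
    let k := (up block γ).pos p
    (T q ((up block γ).1.getI k)).map fun s => match s.2 with
      | .write x => (.write (.inr (flag γ, (up block γ).set k x, low γ)), .top s.1 p)
      | .move .right =>
        if k + 1 < (up block γ).1.length then (.write γ, .top s.1 (clip B (k + 1)))
        else (.right, .top s.1 (clip B 0))
      | .move .left =>
        if k ≠ 0 then (.write γ, .top s.1 (clip B (k - 1)))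
        else if flag γ then (.write γ, .bot s.1) else (.left, .top s.1 (clip B B))
  | .bot q, γ =>
    (T q (low γ)).map fun s => match s.2 with
      | .write x => (.write (.inr (flag γ, up block γ, x)), .bot s.1)
      | .move .left => (.right, .bot s.1)
      | .move .right => if flag γ then (.write γ, .top s.1 (clip B 0)) else (.left, .bot s.1)

/-- Only the leftmost of the given cells is marked. -/
def Marked (l : List (FoldSym α Γ₀ B)) : Prop :=
  ∃ n, l.map FoldSym.flag = true :: List.replicate n false

theorem Marked.flag_eq_true_iff {u v : List (FoldSym α Γ₀ B)} {γ : FoldSym α Γ₀ B}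
    (h : Marked (u ++ γ :: v)) : γ.flag = true ↔ u = [] := by
  obtain ⟨n, h⟩ := h
  cases u with
  | nil => simp_all
  | cons δ u =>
    simp only [List.cons_append, List.map_cons, List.map_append, List.cons.injEq] at h
    have : γ.flag ∈ List.replicate n false := by rw [← h.2]; simp
    simp [List.eq_of_mem_replicate this]

theorem Marked.concat_blank {l : List (FoldSym α Γ₀ B)} (h : Marked l) :
    Marked (l ++ [.inl none]) := by
  obtain ⟨n, h⟩ := h
  exact ⟨n + 1, by simp [h, FoldSym.flag, List.replicate_succ']⟩

theorem Marked.replace {u v : List (FoldSym α Γ₀ B)} {γ δ : FoldSym α Γ₀ B}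
    (h : Marked (u ++ γ :: v)) (hδ : δ.flag = γ.flag) : Marked (u ++ δ :: v) := by
  obtain ⟨n, h⟩ := h
  exact ⟨n, by rw [← h]; simp [hδ]⟩

variable [Inhabited Γ₀]

open FoldSym in
/-- The simulation relation between the folded machine and the original one. -/
inductive FoldRel (block : α → Word Γ₀ B) :
    FoldState Λ B × Tape (FoldSym α Γ₀ B) → TM0.Cfg Γ₀ Λ → Prop
  | top {q p u γ v l x r L R} (hm : Marked (u ++ γ :: v)) (hu : (up block γ).1 = l ++ x :: r)
      (hp : (up block γ).pos p = l.length)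
      (hL : L = ListBlank.mk (l.reverse ++ (u.flatMap fun c => (up block c).1).reverse ++
        (u ++ γ :: v).map low))
      (hR : R = ListBlank.mk (r ++ v.flatMap fun c => (up block c).1)) :
      FoldRel block (.top q p, (u, γ, v)) ⟨q, ⟨x, L, R⟩⟩
  | bot {q u γ v x L R} (hm : Marked (u ++ γ :: v)) (hx : x = low γ)
      (hL : L = ListBlank.mk (v.map low))
      (hR : R = ListBlank.mk ((u.map low).reverse ++
        (u ++ γ :: v).flatMap fun c => (up block c).1)) :
      FoldRel block (.bot q, (u, γ, v)) ⟨q, ⟨x, L, R⟩⟩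

variable {block : α → Word Γ₀ B}

theorem FoldRel.concat_blank {s : FoldState Λ B} {u v : List (FoldSym α Γ₀ B)}
    {γ : FoldSym α Γ₀ B} {c : TM0.Cfg Γ₀ Λ} (h : FoldRel block (s, (u, γ, v)) c) :
    FoldRel block (s, (u, γ, v ++ [.inl none])) c := by
  have hmk : ∀ l : List Γ₀, ListBlank.mk l = ListBlank.mk (l ++ [default]) := fun l =>
    (listBlank_mk_append_replicate l 1).symm
  cases h with
  | top hm hu hp hL hR =>
    refine .top (by simpa using hm.concat_blank) hu hp ?_ ?_
    · rw [hL, hmk]; simp [FoldSym.low]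
    · rw [hR, hmk]; simp [FoldSym.up]
  | bot hm hx hL hR =>
    refine .bot (by simpa using hm.concat_blank) hx ?_ ?_
    · rw [hL, hmk]; simp [FoldSym.low]
    · rw [hR, hmk]; simp [FoldSym.up]

theorem FoldRel.exists_actFun_right {s : FoldState Λ B} {u v : List (FoldSym α Γ₀ B)}
    {γ : FoldSym α Γ₀ B} {c : TM0.Cfg Γ₀ Λ} (h : FoldRel block (s, (u, γ, v)) c) :
    ∃ τ v', FoldRel block (s, (u, γ, τ :: v')) c ∧
      actFun (.inl none) .right (u, γ, v) = (u ++ [γ], τ, v') := by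
  cases v with
  | nil => exact ⟨_, _, h.concat_blank, rfl⟩
  | cons τ v => exact ⟨_, _, h, rfl⟩

/-- The folded machine is in lockstep with the original one. -/
theorem foldRel_step [Inhabited Λ] (T : TM0.Machine Γ₀ Λ) (first : Γ₀)
    {c : FoldState Λ B × Tape (FoldSym α Γ₀ B)} {d : TM0.Cfg Γ₀ Λ} (h : FoldRel block c d) :
    Option.Rel (FoldRel block) (detStep (.inl none) (foldNext T first block) c) (TM0.step T d) := by
  obtain ⟨s, u, γ, v⟩ := c
  have h' := h
  cases h with
  | @top q p _ _ _ l x r L R hm hu hp hL hR =>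
    have hx : (FoldSym.up block γ).1.getI l.length = x := by
      rw [hu]; simp [List.getI_eq_getElem?_getD]
    have hflag := hm.flag_eq_true_iff
    simp only [detStep, foldNext, TM0.step, hp, hx]
    cases hT : T q x with
    | none => exact .none
    | some s =>
      obtain ⟨q', a⟩ := s
      simp only [Option.map_some]
      refine .some ?_
      rcases a with (_ | _) | x'
      · rcases List.eq_nil_or_concat l with rfl | ⟨l, y, rfl⟩
        · rcases List.eq_nil_or_concat u with rfl | ⟨u, τ, rfl⟩
          · simp only [hflag.2 rfl]
            refine .bot hm ?_ ?_ ?_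
            · simp [hL]
            · simp [hL]
            · simp [hR, hu]
          · have hγ : γ.flag = false := by simpa using hflag
            simp only [hγ]
            rcases List.eq_nil_or_concat (FoldSym.up block τ).1 with hn | ⟨l, y, hy⟩
            · exact absurd hn (FoldSym.up block τ).2.1
            · simp only [List.concat_eq_append] at hm hL hy ⊢
              simp only [List.length_nil, ne_eq, not_true_eq_false, if_false, Bool.false_eq_true,
                actFun_left_append]
              refine .top (l := l) (r := []) (by simpa using hm) ?_ ?_ ?_ ?_
              · simp [hL, hy]
              · simp [Word.pos_clip_last, hy]
              · simp [hL, hy]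
              · simp [hR, hu]
        · simp only [List.concat_eq_append] at hu hp hL ⊢
          simp only [List.length_append, List.length_singleton, ne_eq, Nat.add_eq_zero_iff,
            one_ne_zero, and_false, not_false_eq_true, if_true, actFun, Nat.add_sub_cancel]
          refine .top (l := l) (r := x :: r) hm ?_ ?_ ?_ ?_
          · simp [hu, hL]
          · exact Word.pos_clip (by simp [hu])
          · simp [hL]
          · simp [hR]
      · dsimp only
        split_ifs with hlt
        · rcases r with _ | ⟨y, r⟩
          · simp [hu] at hlt
          · refine .top (l := l ++ [x]) (r := r) hm ?_ ?_ ?_ ?_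
            · simp [hu, hR]
            · simpa using Word.pos_clip hlt
            · simp [hL]
            · simp [hR]
        · obtain ⟨τ, v', hr, ha⟩ := h'.exists_actFun_right
          simp only [ha]
          cases hr with
          | @top _ _ _ _ _ l' _ r _ _ hm hu' hp' hL hR =>
            have hr : r = [] := by
              have := congrArg List.length hu'
              simp only [List.length_append, List.length_cons] at this
              exact List.length_eq_zero_iff.1 (by omega)
            subst hr
            rcases hτ : (FoldSym.up block τ).1 with _ | ⟨y, s⟩
            · exact absurd hτ (FoldSym.up block τ).2.1
            · refine .top (l := []) (r := s) (by simpa using hm) ?_ ?_ ?_ ?_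
              · simp [hR, hτ]
              · exact Word.pos_clip (by simp [hτ])
              · simp [hL, hu']
              · simp [hR, hτ]
      · refine .top (l := l) (r := r) ?_ ?_ ?_ ?_ ?_
        · exact hm.replace rfl
        · change (FoldSym.up block γ).1.set l.length x' = _
          simp [hu]
        · simpa [FoldSym.up, Word.set, Word.pos] using hp
        · simp [hL, FoldSym.low]
        · exact hR
  | @bot q _ _ _ x L R hm hx hL hR =>
    subst hx
    have hflag := hm.flag_eq_true_iff
    simp only [detStep, foldNext, TM0.step]
    cases hT : T q (FoldSym.low γ) with
    | none => exact .none
    | some s =>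
      obtain ⟨q', a⟩ := s
      simp only [Option.map_some]
      refine .some ?_
      rcases a with (_ | _) | x'
      · obtain ⟨τ, v', hr, ha⟩ := h'.exists_actFun_right
        simp only [ha]
        cases hr with
        | bot hm hx hL hR =>
          refine .bot (by simpa using hm) ?_ ?_ ?_
          · simp [hL]
          · simp [hL]
          · simp [hR]
      · dsimp only
        split_ifs with hγ
        · obtain rfl := hflag.1 hγ
          rcases hw : (FoldSym.up block γ).1 with _ | ⟨y, s⟩
          · exact absurd hw (FoldSym.up block γ).2.1
          · refine .top (l := []) (r := s) hm ?_ ?_ ?_ ?_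
            · simp [hR, hw]
            · exact Word.pos_clip (by simp [hw])
            · simp [hL]
            · simp [hR, hw]
        · rcases List.eq_nil_or_concat u with rfl | ⟨u, τ, rfl⟩
          · exact absurd (hflag.2 rfl) hγ
          · simp only [List.concat_eq_append] at hm hR ⊢
            simp only [actFun_left_append]
            refine .bot (by simpa using hm) ?_ ?_ ?_
            · simp [hR]
            · simp [hL]
            · simp [hR]
      · refine .bot (hm.replace rfl) ?_ ?_ ?_
        · rfl
        · exact hL
        · simp [hR, FoldSym.up]

/-- A Turing machine with a two-sided tape whose input is a letter followed by the translation of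
a word, letter by letter, can be simulated by a `Σ₁` alternating machine on that word. -/
theorem exists_ATM_of_TM0 [Finite α] [Finite Γ₀] [Finite Λ] [Inhabited Λ]
    (T : TM0.Machine Γ₀ Λ) (first : Γ₀) (block : α → List Γ₀) (hblock : ∀ a, block a ≠ []) :
    ∃ (Γ : Type) (M : ATM α Γ), M.IsSigmaM 1 ∧
      ∀ w, M.Accepts w ↔ (TM0.eval T (first :: w.flatMap block)).Dom := by
  obtain ⟨B, hB⟩ := (Set.finite_range fun a => (block a).length).bddAbove
  have hlen : ∀ a, (block a).length ≤ B + 1 := fun a => (hB ⟨a, rfl⟩).trans B.le_succ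
  let block' : α → Word Γ₀ B := fun a => ⟨block a, hblock a, hlen a⟩
  obtain ⟨emb, hemb⟩ : ∃ emb : α ↪ FoldSym α Γ₀ B, ∀ a, emb a = .inl (some a) :=
    ⟨Function.Embedding.some.trans .inl, fun _ => rfl⟩
  refine ⟨_, haltATM emb (.inl none) (fun a => by simp [hemb]) .start (foldNext T first block'),
    haltATM_isSigmaM, fun w => ?_⟩
  have hres : StateTransition.Respects (detStep (.inl none) (foldNext T first block'))
      (TM0.step T) (FoldRel block') := by
    intro c d h
    have := foldRel_step T first h
    generalize detStep (.inl none) (foldNext T first block') c = c', hd : TM0.step T d = d'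
      at this ⊢
    rcases this with h | _
    · exact ⟨_, h, .single hd⟩
    · rfl
  have hstart : detStep (.inl none) (foldNext T first block')
      (.start, ([], .inl none, w.map emb)) = some (.top default (clip B 0),
        ([], .inr (true, ⟨[first], by simp⟩, default), w.map emb)) := rfl
  have hrel : FoldRel block' (.top default (clip B 0),
      ([], .inr (true, ⟨[first], by simp⟩, default), w.map emb))
      (TM0.init (Λ := Λ) (first :: w.flatMap block)) := by
    refine .top (l := []) (r := []) ⟨w.length, ?_⟩ rfl ?_ ?_ ?_
    · simp [FoldSym.flag, Function.comp_def, hemb]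
    · simp [Word.pos, FoldSym.up]
    · rw [← listBlank_mk_append_replicate _ (w.length + 1)]
      simp [FoldSym.low, Function.comp_def, hemb, List.replicate_succ]
    · simp [List.flatMap_map, FoldSym.up, hemb, block']
  rw [haltATM_accepts_iff, StateTransition.reaches_eval (.single hstart)]
  exact (StateTransition.tr_eval_dom hres hrel).symm

end Folding

end ATMPaper

namespace ATMPaper

open Turing Turing.PartrecToTM2 Turing.ToPartrec

/-- The tape symbol that holds `s` on the main stack and whose bottom mark is `b`. -/
def mainSym (b : Bool) (s : PartrecToTM2.Γ') : CodeSym :=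
  (b, Function.update (fun _ => none) K'.main (some s))

/-- The cells of the initial tape that encode the letter `a`. -/
def codeBlock {α : Type} [Primcodable α] (a : α) : List CodeSym :=
  (trNat (Encodable.encode a + 1) ++ [PartrecToTM2.Γ'.cons]).reverse.map (mainSym false)

theorem trList_eq_flatMap (v : List ℕ) :
    trList v = v.flatMap fun n => trNat n ++ [PartrecToTM2.Γ'.cons] := by
  induction v with
  | nil => rfl
  | cons n v ih => simp [trList, ih]

theorem trInit_trList {α : Type} [Primcodable α] (w : List α) :
    TM2to1.trInit K'.main (trList (w.reverse.map (fun a => Encodable.encode a + 1) ++ [0])) =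
      mainSym true PartrecToTM2.Γ'.cons :: w.flatMap codeBlock := by
  have h : (trList (w.reverse.map (fun a => Encodable.encode a + 1) ++ [0])).reverse =
      PartrecToTM2.Γ'.cons :: w.flatMap fun a =>
        (trNat (Encodable.encode a + 1) ++ [PartrecToTM2.Γ'.cons]).reverse := by
    rw [trList_eq_flatMap, List.reverse_flatMap]
    simp [List.flatMap_map, Function.comp_def]
  unfold TM2to1.trInit
  rw [h]
  change mainSym true _ :: List.map (mainSym false) _ = _
  rw [List.map_flatMap]
  rfl

theorem exists_ATM_of_rePred {α : Type} [Finite α] [Primcodable α] {L : List α → Prop}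
    (hL : REPred L) : ∃ (Γ : Type) (M : ATM α Γ), M.IsSigmaM 1 ∧ ∀ w, M.Accepts w ↔ L w := by
  obtain ⟨c, hc⟩ := exists_code_of_rePred hL
  obtain ⟨Λ, _, _, T, hT⟩ := exists_TM0_of_code c
  obtain ⟨Γ, M, hM, h⟩ := exists_ATM_of_TM0 T (mainSym true PartrecToTM2.Γ'.cons)
    (codeBlock (α := α)) (fun a => by simp only [codeBlock]; simp)
  refine ⟨Γ, M, hM, fun w => ?_⟩
  rw [h, ← trInit_trList, hT, hc]

theorem rePred_exists {α β : Type} [Primcodable α] [Primcodable β] {R : α × β → Prop}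
    (hR : ComputablePred R) : REPred fun a => ∃ b, R (a, b) := by
  obtain ⟨_, hR⟩ := hR
  let f : α → ℕ → Option Unit := fun a n =>
    (Encodable.decode (α := β) n).bind fun b => bif decide (R (a, b)) then some () else none
  have hf : Computable₂ f := by
    refine Computable.option_bind (Computable.decode.comp Computable.snd) ?_
    exact Computable.cond (hR.comp
      ((Computable.fst.comp Computable.fst).pair Computable.snd))
      (Computable.const _) (Computable.const _)
  refine (Partrec.rfindOpt hf).of_eq fun a => Part.ext' ?_ fun _ _ => rfl
  rw [Nat.rfindOpt_dom]
  change _ ↔ ∃ _ : (∃ b, R (a, b)), True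
  simp only [exists_prop, and_true]
  constructor
  · rintro ⟨n, u, h⟩
    obtain ⟨b, -, hb⟩ := Option.bind_eq_some_iff.1 h
    exact ⟨b, by by_contra hn; simp [hn] at hb⟩
  · rintro ⟨b, hb⟩
    exact ⟨Encodable.encode b, (), by simp [f, hb]⟩

end ATMPaper

namespace ATMPaper

section Alternation

variable {α Γ : Type} {M : ATM α Γ}

theorem exists_seq_of_reflTransGen {C : Type} {r : C → C → Prop} {a b c : C}
    (hab : Relation.ReflTransGen r a b) (hbc : Relation.ReflTransGen r b c) :
    ∃ (i n : ℕ) (d : ℕ → C), i ≤ n ∧ d 0 = a ∧ d i = b ∧ d n = c ∧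
      ∀ j < n, r (d j) (d (j + 1)) := by
  have hcons : ∀ {x y : C} {n : ℕ} {d : ℕ → C}, r x y → d 0 = y →
      (∀ j < n, r (d j) (d (j + 1))) → ∀ j < n + 1,
        r (Nat.casesOn j x d) (Nat.casesOn (j + 1) x d) := by
    intro x y n d hxy h0 hd j hj
    cases j with
    | zero => simpa [h0] using hxy
    | succ j => exact hd j (by omega)
  induction hab using Relation.ReflTransGen.head_induction_on with
  | refl =>
    induction hbc using Relation.ReflTransGen.head_induction_on with
    | refl => exact ⟨0, 0, fun _ => c, le_rfl, rfl, rfl, rfl, by simp⟩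
    | @head x y hxy _ ih =>
      obtain ⟨i, n, d, -, h0, -, hn, hd⟩ := ih
      exact ⟨0, n + 1, fun j => Nat.casesOn j x d, by omega, rfl, rfl, hn, hcons hxy h0 hd⟩
  | @head x y hxy _ ih =>
    obtain ⟨i, n, d, hin, h0, hi, hn, hd⟩ := ih
    exact ⟨i + 1, n + 1, fun j => Nat.casesOn j x d, by omega, rfl, hi, hn, hcons hxy h0 hd⟩

theorem exists_ne_succ {f : ℕ → Bool} {i j : ℕ} (hij : i ≤ j) (h : f i ≠ f j) :
    ∃ k, i ≤ k ∧ k < j ∧ f k ≠ f (k + 1) := by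
  induction j, hij using Nat.le_induction with
  | base => exact absurd rfl h
  | succ j hij ih =>
    by_cases hj : f i = f j
    · exact ⟨j, hij, by omega, hj ▸ h⟩
    · obtain ⟨k, h₁, h₂, h₃⟩ := ih hj
      exact ⟨k, h₁, by omega, h₃⟩

theorem EChain.reaches {C : Type} {isE : C → Bool} {step : C → C → Prop} {c c' : C}
    (h : EChain isE step c c') : Relation.ReflTransGen step c c' := by
  induction h with
  | refl => exact .refl
  | step _ hs _ ih => exact .head hs ih

theorem UChain.reaches {C : Type} {isE : C → Bool} {step : C → C → Prop} {c c' : C}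
    (h : UChain isE step c c') : Relation.ReflTransGen step c c' := by
  induction h with
  | refl => exact .refl
  | step _ hs _ ih => exact .head hs ih

theorem exists_ePivot {C : Type} {isE : C → Bool} {step : C → C → Prop} {c c' : C}
    (h : Relation.ReflTransGen step c c') (hc' : isE c' = false) :
    ∃ d, EPivot isE step c d := by
  induction h using Relation.ReflTransGen.head_induction_on with
  | refl => exact ⟨_, .refl _, hc'⟩
  | @head x y hxy _ ih =>
    obtain ⟨d, hd, hd'⟩ := ih
    cases hx : isE x with
    | true => exact ⟨d, .step hx hxy hd, hd'⟩
    | false => exact ⟨x, .refl _, hx⟩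

/-- A `Σ₁` machine accepts `w` iff a universal configuration is reachable. -/
theorem accepts_iff_of_isSigmaM_one (hM : M.IsSigmaM 1) (w : List α) :
    M.Accepts w ↔ ∃ c, Relation.ReflTransGen M.Yield (M.init w) c ∧ M.cfgE c = false := by
  have hinit : M.cfgE (M.init w) = true := hM.1
  constructor
  · intro h
    cases h with
    | ex _ hp _ => exact ⟨_, hp.1.reaches, hp.2⟩
    | univ h _ => simp [hinit] at h
  · rintro ⟨c, hc, hcE⟩
    obtain ⟨d, hd, hdE⟩ := exists_ePivot hc hcE
    refine .ex hinit ⟨hd, hdE⟩ (.univ hdE fun c' hc' => ?_)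
    obtain ⟨i, n, f, hin, h0, hi, hn, hf⟩ :=
      exists_seq_of_reflTransGen hd.reaches hc'.1.reaches
    obtain ⟨j, -, hj, hj'⟩ := exists_ne_succ (f := fun j => M.cfgE (f j)) (Nat.zero_le i)
      (by simp [h0, hi, hinit, hdE])
    obtain ⟨k, hk, hk', hk''⟩ := exists_ne_succ (f := fun j => M.cfgE (f j)) hin
      (by simp [hi, hn, hdE, hc'.2])
    have := Finset.card_le_one.1 (hM.2 w n f h0 hf) j
      (Finset.mem_filter.2 ⟨Finset.mem_range.2 (by omega), hj'⟩) k
      (Finset.mem_filter.2 ⟨Finset.mem_range.2 hk', hk''⟩)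
    omega

end Alternation

section Computability

variable {α Γ : Type}

theorem primrec_flatMap_const {ι β σ : Type} [Primcodable β] [Primcodable σ]
    {f : ι → β → List σ} (l : List ι) (hf : ∀ i, Primrec (f i)) :
    Primrec fun b => l.flatMap fun i => f i b := by
  induction l with
  | nil => exact Primrec.const []
  | cons i l ih => exact Primrec.list_append.comp (hf i) ih

theorem primrec_actFun [Primcodable Γ] (blank : Γ) (a : Act Γ) : Primrec (actFun blank a) := by
  have h₁ : Primrec fun t : Tape Γ => t.1 := Primrec.fst
  have h₂ : Primrec fun t : Tape Γ => t.2.1 := Primrec.fst.comp Primrec.snd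
  have h₃ : Primrec fun t : Tape Γ => t.2.2 := Primrec.snd.comp Primrec.snd
  cases a with
  | write τ => exact h₁.pair ((Primrec.const τ).pair h₃)
  | right =>
    refine ((Primrec.list_concat.comp h₁ h₂).pair
      ((Primrec.option_getD.comp (Primrec.list_head?.comp h₃) (Primrec.const blank)).pair
        (Primrec.list_tail.comp h₃))).of_eq fun t => ?_
    simp [actFun, List.headD_eq_head?_getD]
  | left =>
    have hu : Primrec fun t : Tape Γ => t.1.reverse.tail.reverse :=
      Primrec.list_reverse.comp (Primrec.list_tail.comp (Primrec.list_reverse.comp h₁))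
    refine (Primrec.option_casesOn (Primrec.list_head?.comp (Primrec.list_reverse.comp h₁))
      Primrec.id (((hu.comp Primrec.fst).pair (Primrec.snd.pair
        ((Primrec.list_cons.comp h₂ h₃).comp Primrec.fst))).to₂)).of_eq fun t => ?_
    simp only [actFun, List.head?_reverse]
    cases t.1.getLast? <;> simp

/-- The configurations reached from `l` in one step, by actions and states listed in `rules`. -/
def successors (M : ATM α Γ) [∀ q γ a q', Decidable (M.δ q γ a q')] (rules : List (Act Γ × M.Q))
    (c : M.Cfg) : List M.Cfg :=
  rules.flatMap fun r =>
    if M.δ c.1 (Tape.scan c.2) r.1 r.2 then [(r.2, actFun M.blank r.1 c.2)] else []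

instance [Finite Γ] : Finite (Act Γ) :=
  Finite.of_surjective
    (fun s : Γ ⊕ Bool => match s with
      | .inl τ => .write τ
      | .inr false => .left
      | .inr true => .right)
    fun a => match a with
      | .write τ => ⟨.inl τ, rfl⟩
      | .left => ⟨.inr false, rfl⟩
      | .right => ⟨.inr true, rfl⟩

theorem mem_iterate_flatMap {C : Type} (next : C → List C) (c d : C) :
    (∃ n, d ∈ (fun l : List C => l.flatMap next)^[n] [c]) ↔
      Relation.ReflTransGen (fun x y => y ∈ next x) c d := by
  constructor
  · rintro ⟨n, hn⟩
    induction n generalizing d with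
    | zero => simp at hn; exact hn ▸ .refl
    | succ n ih =>
      rw [Function.iterate_succ_apply', List.mem_flatMap] at hn
      obtain ⟨x, hx, hd⟩ := hn
      exact .tail (ih x hx) hd
  · intro h
    induction h with
    | refl => exact ⟨0, by simp⟩
    | tail _ h ih =>
      obtain ⟨n, hn⟩ := ih
      refine ⟨n + 1, ?_⟩
      rw [Function.iterate_succ_apply', List.mem_flatMap]
      exact ⟨_, hn, h⟩

theorem exists_computablePred_of_isSigmaM_one [Finite α] [Primcodable α] (M : ATM α Γ)
    (hM : M.IsSigmaM 1) : ∃ R : List α × List α → Prop, ComputablePred R ∧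
      ∀ w, M.Accepts w ↔ ∃ x, R (w, x) := by
  classical
  rcases isEmpty_or_nonempty α with _ | ⟨⟨a⟩⟩
  · refine ⟨fun _ => M.Accepts [],
      ⟨fun _ => Classical.dec _, (Computable.const (decide (M.Accepts []))).of_eq fun _ => ?_⟩,
      fun w => ?_⟩
    · exact decide_eq_decide.2 Iff.rfl
    rw [Subsingleton.elim w []]
    simp
  have := M.ΓFin
  have := M.QFin
  obtain ⟨_, ⟨eΓ⟩⟩ := Finite.exists_equiv_fin Γ
  obtain ⟨_, ⟨eQ⟩⟩ := Finite.exists_equiv_fin M.Q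
  let _ : Primcodable Γ := Primcodable.ofEquiv _ eΓ
  let _ : Primcodable M.Q := Primcodable.ofEquiv _ eQ
  obtain ⟨rules, -, hrules⟩ := Finite.exists_univ_list (Act Γ × M.Q)
  have hyield : ∀ c c' : M.Cfg, M.Yield c c' ↔ c' ∈ successors M rules c := by
    intro c c'
    simp only [ATM.Yield, actStep_iff, successors, List.mem_flatMap]
    constructor
    · rintro ⟨a, h, h'⟩
      exact ⟨(a, c'.1), hrules _, by simp [h, ← h']⟩
    · rintro ⟨r, -, hr⟩
      split_ifs at hr with h
      · obtain rfl := List.mem_singleton.1 hr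
        exact ⟨_, h, rfl⟩
      · cases hr
  have hnext : Primrec (successors M rules) := by
    refine primrec_flatMap_const rules fun r => ?_
    have hδ : PrimrecPred fun c : M.Cfg => M.δ c.1 (Tape.scan c.2) r.1 r.2 :=
      ⟨inferInstance, (Primrec.dom_finite fun p : M.Q × Γ => decide (M.δ p.1 p.2 r.1 r.2)).comp
        (Primrec.fst.pair (Primrec.fst.comp (Primrec.snd.comp Primrec.snd)))⟩
    exact Primrec.ite hδ (Primrec.list_cons.comp ((Primrec.const r.2).pair
      ((primrec_actFun M.blank r.1).comp Primrec.snd)) (Primrec.const [])) (Primrec.const [])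
  have hinit : Primrec M.init :=
    (Primrec.const M.start).pair ((Primrec.const []).pair ((Primrec.const M.blank).pair
      (Primrec.list_map Primrec.id ((Primrec.dom_finite M.emb).comp Primrec.snd).to₂)))
  have hiter : Primrec fun p : List α × List α =>
      (fun l : List M.Cfg => l.flatMap (successors M rules))^[p.2.length] [M.init p.1] :=
    Primrec.nat_iterate (Primrec.list_length.comp Primrec.snd)
      (Primrec.list_cons.comp (hinit.comp Primrec.fst) (Primrec.const []))
      (Primrec.list_flatMap Primrec.snd (hnext.comp Primrec.snd).to₂).to₂
  have huniv : PrimrecPred fun c : M.Cfg => M.cfgE c = false :=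
    ⟨inferInstance, (Primrec.dom_finite fun q => decide (M.isE q = false)).comp Primrec.fst⟩
  obtain ⟨hdec, hR⟩ := huniv.exists_mem_list.comp hiter
  refine ⟨_, ⟨hdec, hR.to_comp⟩, fun w => ?_⟩
  have hreach := fun d => mem_iterate_flatMap (successors M rules) (M.init w) d
  simp only [← hyield] at hreach
  rw [accepts_iff_of_isSigmaM_one hM]
  constructor
  · rintro ⟨c, hc, hE⟩
    obtain ⟨n, hn⟩ := (hreach c).2 hc
    exact ⟨List.replicate n a, c, by simpa using hn, hE⟩
  · rintro ⟨x, c, hc, hE⟩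
    exact ⟨c, (hreach c).1 ⟨_, hc⟩, hE⟩

end Computability

end ATMPaper

open ATMPaper in
/-- a language `L ⊆ Σ*` is `Σ⁰₁` (computably enumerable) iff
`L = L(M)` for some `Σ₁` alternating Turing machine `M`. -/
theorem stmt11 {α : Type} [Fintype α] [Primcodable α] (L : Set (List α)) :
    (∃ R : List α × List α → Prop, ComputablePred R ∧
        L = {w | ∃ x : List α, R (w, x)}) ↔
      ∃ (Γ : Type) (M : ATM α Γ), M.IsSigmaM 1 ∧ L = M.Lang := by
  constructor
  · rintro ⟨R, hR, rfl⟩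
    obtain ⟨Γ, M, hM, h⟩ := exists_ATM_of_rePred (rePred_exists hR)
    exact ⟨Γ, M, hM, Set.ext fun w => (h w).symm⟩
  · rintro ⟨Γ, M, hM, rfl⟩
    obtain ⟨R, hR, h⟩ := exists_computablePred_of_isSigmaM_one M hM
    exact ⟨R, hR, Set.ext h⟩
end
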